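/- Let G ∼ D(n,p) and let k < n. Let c = c_1 c_2 ⋯ c_{k+1} be a trail of size k with no two equal consecutive nodes, let {i_1,…,i_s} be the distinct nodes among c_1,…,c_k, for each r ∈ [s] let m_r be the number of occurrences of i_r among c_1,…,c_k, and let |c| denote the number of distinct directed edges among (c_1,c_2),…,(c_k,c_{k+1}). Then E(f_{i_1}^{m_1} ⋯ f_{i_s}^{m_s} | 1_c = 1) ≤ k^{k−|c|}/(p^k(n−k)^k). -/

import Mathlib

open Finset Filter Topology Matrix

attribute [local instance] Classical.propDecidable

noncomputable section

/-- The set of possible directed edges of a simple directed graph on `Fin n`: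
all ordered pairs `(i,j)` with `i ≠ j`.  A directed graph `G ∈ 𝔻ₙ` is
identified with its edge set, a subset of `allDirEdges n`. -/
def allDirEdges (n : ℕ) : Finset (Fin n × Fin n) :=
  Finset.univ.filter fun e => e.1 ≠ e.2

/-- Probability weight of a given edge set in the directed Erdős–Rényi model
`D(n,p)`. -/
def dProb (n : ℕ) (p : ℝ) (E : Finset (Fin n × Fin n)) : ℝ :=
  p ^ E.card * (1 - p) ^ ((allDirEdges n).card - E.card)

/-- Expectation of a real random variable in the directed Erdős–Rényi model
`D(n,p)`. -/
def dExp (n : ℕ) (p : ℝ) (X : Finset (Fin n × Fin n) → ℝ) : ℝ :=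
  ∑ E ∈ (allDirEdges n).powerset, dProb n p E * X E

/-- Out-degree of the node `i` in the directed graph with edge set `E`. -/
def degPlus (n : ℕ) (E : Finset (Fin n × Fin n)) (i : Fin n) : ℕ :=
  (Finset.univ.filter fun j => j ≠ i ∧ (i, j) ∈ E).card

/-- Truncated inverse out-degree `f_i`. -/
def finvD (n : ℕ) (E : Finset (Fin n × Fin n)) (i : Fin n) : ℝ :=
  if degPlus n E i = 0 then 0 else 1 / (degPlus n E i : ℝ)

/-- The opinion-dynamics matrix `H(G)` of a directed graph, with condescendence
parameters `α`. -/
def HmatD (n : ℕ) (α : Fin n → ℝ) (E : Finset (Fin n × Fin n)) : Matrix (Fin n) (Fin n) ℝ :=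
  Matrix.of fun i j =>
    if degPlus n E i = 0 then (if i = j then α i else 0)
    else if i ≠ j ∧ (i, j) ∈ E then α i / (degPlus n E i : ℝ) else 0

/-- Entrywise expectation of a random matrix in the directed Erdős–Rényi model
`D(n,p)`. -/
def dExpMat (n : ℕ) (p : ℝ) (M : Finset (Fin n × Fin n) → Matrix (Fin n) (Fin n) ℝ) :
    Matrix (Fin n) (Fin n) ℝ :=
  Matrix.of fun i j => dExp n p fun E => M E i j

/-- Conditional expectation `E(X | A)` given an event `A`. -/
def dCondExp (n : ℕ) (p : ℝ) (X : Finset (Fin n × Fin n) → ℝ)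
    (A : Finset (Fin n × Fin n) → Prop) : ℝ :=
  dExp n p (fun E => if A E then X E else 0) / dExp n p (fun E => if A E then 1 else 0)

/-- The matrix norm `‖M‖_* = max_i Σ_j |M i j|` induced by the `ℓ∞` norm. -/
def starNorm {n : ℕ} (M : Matrix (Fin n) (Fin n) ℝ) : ℝ :=
  ⨆ i, ∑ j, |M i j|

/-- The opinion-dynamics iterates `x(G,t)`: `x(G,0) = x0`,
`x(G,t+1) = H x(G,t) + B x0`. -/
def dynD (n : ℕ) (H B : Matrix (Fin n) (Fin n) ℝ) (x0 : Fin n → ℝ) : ℕ → Fin n → ℝ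
  | 0 => x0
  | t + 1 => H *ᵥ dynD n H B x0 t + B *ᵥ x0

lemma choose_mul_ascFactorial (N m j : ℕ) (hj : j ≤ N) :
    N.choose j * (N + 1).ascFactorial m = (N + m).choose (j + m) * (j + 1).ascFactorial m := by
  have h1 := Nat.choose_mul_factorial_mul_factorial hj
  have h2 := Nat.choose_mul_factorial_mul_factorial (Nat.add_le_add_right hj m)
  rw [Nat.add_sub_add_right, ← Nat.factorial_mul_ascFactorial N,
    ← Nat.factorial_mul_ascFactorial j] at h2
  have hpos : 0 < j.factorial * (N - j).factorial :=
    Nat.mul_pos (Nat.factorial_pos _) (Nat.factorial_pos _)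
  refine Nat.eq_of_mul_eq_mul_right hpos ?_
  calc _ = (N.choose j * j.factorial * (N - j).factorial) * (N + 1).ascFactorial m := by ring
    _ = N.factorial * (N + 1).ascFactorial m := by rw [h1]
    _ = _ := by rw [← h2]; ring

/-- The inverse rising-factorial moment of a binomial variable. -/
lemma sum_binomial_div_ascFactorial_le (N m : ℕ) {p : ℝ} (hp0 : 0 < p) (hp1 : p < 1) :
    ∑ j ∈ range (N + 1), (N.choose j : ℝ) * (p ^ j * (1 - p) ^ (N - j)) *
        (1 / ((j + 1).ascFactorial m : ℝ)) ≤ 1 / (p ^ m * ((N + 1).ascFactorial m : ℝ)) := by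
  have hq : 0 ≤ 1 - p := by linarith
  have hpos : ∀ a : ℕ, (0 : ℝ) < ((a + 1).ascFactorial m : ℝ) := fun a => by
    exact_mod_cast Nat.ascFactorial_pos a m
  rw [le_div_iff₀ (mul_pos (pow_pos hp0 m) (hpos N)), sum_mul]
  have hbin : ∑ i ∈ range (N + m + 1),
      p ^ i * (1 - p) ^ (N + m - i) * ((N + m).choose i : ℝ) = 1 := by
    rw [← add_pow, add_sub_cancel, one_pow]
  rw [show N + m + 1 = m + (N + 1) by ring, sum_range_add] at hbin
  have hterm : ∀ j ∈ range (N + 1), (N.choose j : ℝ) * (p ^ j * (1 - p) ^ (N - j)) *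
        (1 / ((j + 1).ascFactorial m : ℝ)) * (p ^ m * ((N + 1).ascFactorial m : ℝ)) =
      p ^ (m + j) * (1 - p) ^ (N + m - (m + j)) * ((N + m).choose (m + j) : ℝ) := by
    intro j hj
    have hjN : j ≤ N := by simpa [Nat.lt_succ_iff] using hj
    have h : (N.choose j : ℝ) * ((N + 1).ascFactorial m : ℝ) =
        ((N + m).choose (j + m) : ℝ) * ((j + 1).ascFactorial m : ℝ) := by
      exact_mod_cast choose_mul_ascFactorial N m j hjN
    rw [show N + m - (m + j) = N - j by omega, add_comm m j, pow_add]
    have hne := (hpos j).ne'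
    field_simp
    linear_combination (1 - p) ^ (N - j) * h
  rw [sum_congr rfl hterm]
  refine le_trans ?_ hbin.le
  refine le_add_of_nonneg_left (sum_nonneg fun i _ => ?_)
  positivity

lemma ascFactorial_le_pow_mul_pow {b m k : ℕ} (j : ℕ) (hb : b = 0 → m = 0) (hbm : b ≤ m)
    (hmk : m ≤ k) : (j + 1).ascFactorial m ≤ k ^ (m - b) * (j + b) ^ m := by
  obtain ⟨d, rfl⟩ := Nat.exists_eq_add_of_le hbm
  rw [Nat.add_sub_cancel_left, ← Nat.ascFactorial_mul_ascFactorial, pow_add,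
    show j + 1 + b = j + b + 1 by ring]
  have h1 : (j + 1).ascFactorial b ≤ (j + b) ^ b := Nat.ascFactorial_le_pow_add j b
  have h2 : (j + b + 1).ascFactorial d ≤ k ^ d * (j + b) ^ d := by
    refine (Nat.ascFactorial_le_pow_add (j + b) d).trans ?_
    rw [← mul_pow]
    rcases Nat.eq_zero_or_pos b with h | h
    · have := hb h
      obtain rfl : d = 0 := by omega
      simp
    · exact Nat.pow_le_pow_left (by nlinarith [Nat.zero_le j]) d
  calc _ ≤ (j + b) ^ b * (k ^ d * (j + b) ^ d) := Nat.mul_le_mul h1 h2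
    _ = _ := by ring

/-- An inverse moment of a shifted binomial variable. -/
lemma sum_binomial_inv_pow_le {N b m k : ℕ} {p D : ℝ} (hp0 : 0 < p) (hp1 : p < 1)
    (hb : b = 0 → m = 0) (hbm : b ≤ m) (hmk : m ≤ k) (hD0 : 0 < D) (hD : 0 < m → D ≤ N + 1) :
    ∑ j ∈ range (N + 1), (N.choose j : ℝ) * (p ^ j * (1 - p) ^ (N - j)) *
        (1 / ((j + b : ℕ) : ℝ)) ^ m ≤ (k : ℝ) ^ (m - b) / (p ^ m * D ^ m) := by
  have hq : 0 ≤ 1 - p := by linarith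
  have hpos : ∀ a : ℕ, (0 : ℝ) < ((a + 1).ascFactorial m : ℝ) := fun a => by
    exact_mod_cast Nat.ascFactorial_pos a m
  calc _ ≤ ∑ j ∈ range (N + 1), (N.choose j : ℝ) * (p ^ j * (1 - p) ^ (N - j)) *
        ((k : ℝ) ^ (m - b) * (1 / ((j + 1).ascFactorial m : ℝ))) := by
        refine sum_le_sum fun j _ => mul_le_mul_of_nonneg_left ?_ (by positivity)
        have h : ((j + 1).ascFactorial m : ℝ) ≤ (k : ℝ) ^ (m - b) * ((j + b : ℕ) : ℝ) ^ m := by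
          exact_mod_cast ascFactorial_le_pow_mul_pow j hb hbm hmk
        have h0 : (0 : ℝ) < ((j + b : ℕ) : ℝ) ^ m := by
          by_contra hcon
          have : ((j + b : ℕ) : ℝ) ^ m = 0 := le_antisymm (not_lt.mp hcon) (by positivity)
          rw [this, mul_zero] at h
          exact absurd (hpos j) (not_lt.mpr h)
        rw [div_pow, one_pow, mul_one_div, div_le_div_iff₀ h0 (hpos j), one_mul]
        exact h
    _ = (k : ℝ) ^ (m - b) * ∑ j ∈ range (N + 1), (N.choose j : ℝ) *
        (p ^ j * (1 - p) ^ (N - j)) * (1 / ((j + 1).ascFactorial m : ℝ)) := by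
        rw [mul_sum]
        exact sum_congr rfl fun j _ => by ring
    _ ≤ (k : ℝ) ^ (m - b) * (1 / (p ^ m * ((N + 1).ascFactorial m : ℝ))) :=
        mul_le_mul_of_nonneg_left (sum_binomial_div_ascFactorial_le N m hp0 hp1) (by positivity)
    _ ≤ (k : ℝ) ^ (m - b) * (1 / (p ^ m * D ^ m)) := by
        refine mul_le_mul_of_nonneg_left ?_ (by positivity)
        refine one_div_le_one_div_of_le (by positivity) ?_
        refine mul_le_mul_of_nonneg_left ?_ (by positivity)
        rcases Nat.eq_zero_or_pos m with rfl | hm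
        · simp
        · calc D ^ m ≤ ((N : ℝ) + 1) ^ m := pow_le_pow_left₀ hD0.le (hD hm) m
            _ ≤ _ := by exact_mod_cast Nat.pow_succ_le_ascFactorial (N + 1) m
    _ = _ := by rw [mul_one_div]

/-- Summation over the subsets of `A` that contain `B`, for a cardinality-dependent summand. -/
lemma sum_powerset_superset {α : Type*} [DecidableEq α] {A B : Finset α} (hBA : B ⊆ A) (p : ℝ) (φ : ℕ → ℝ) :
    ∑ S ∈ A.powerset, p ^ S.card * (1 - p) ^ (A.card - S.card) *
        (if B ⊆ S then φ S.card else 0) =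
      p ^ B.card * ∑ j ∈ range ((A \ B).card + 1), ((A \ B).card.choose j : ℝ) *
        (p ^ j * (1 - p) ^ ((A \ B).card - j)) * φ (j + B.card) := by
  have hA : (A \ B).card + B.card = A.card := card_sdiff_add_card_eq_card hBA
  have hpow := sum_powerset_apply_card (x := A \ B)
    (fun j => p ^ j * (1 - p) ^ ((A \ B).card - j) * φ (j + B.card))
  simp only [nsmul_eq_mul, ← mul_assoc] at hpow ⊢
  rw [← hpow, mul_sum]
  simp only [mul_ite, mul_zero]
  rw [← sum_filter]
  refine sum_nbij' (fun S => S \ B) (fun U => U ∪ B) ?_ ?_ ?_ ?_ ?_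
  · intro S hS
    simp only [mem_filter, mem_powerset] at hS ⊢
    exact sdiff_subset_sdiff hS.1 subset_rfl
  · intro U hU
    simp only [mem_filter, mem_powerset] at hU ⊢
    exact ⟨union_subset (hU.trans sdiff_subset) hBA, subset_union_right⟩
  · intro S hS
    simp only [mem_filter] at hS
    exact sdiff_union_of_subset hS.2
  · intro U hU
    rw [mem_powerset] at hU
    exact union_sdiff_cancel_right (disjoint_sdiff_self_left.mono_left hU)
  · intro S hS
    simp only [mem_filter] at hS
    have hS' : (S \ B).card + B.card = S.card := card_sdiff_add_card_eq_card hS.2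
    rw [hS', ← hS', ← hA, Nat.add_sub_add_right, pow_add]
    ring

/-- The out-neighbourhood of `i` in the edge set `E`. -/
def outNbrs (n : ℕ) (E : Finset (Fin n × Fin n)) (i : Fin n) : Finset (Fin n) :=
  Finset.univ.filter fun j => (i, j) ∈ E

lemma mem_outNbrs {n : ℕ} {E : Finset (Fin n × Fin n)} {i j : Fin n} :
    j ∈ outNbrs n E i ↔ (i, j) ∈ E := by
  simp [outNbrs]

lemma sum_card_outNbrs (n : ℕ) (E : Finset (Fin n × Fin n)) :
    ∑ i, (outNbrs n E i).card = E.card := by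
  rw [card_eq_sum_card_fiberwise (f := Prod.fst) (t := univ) (fun _ _ => by simp)]
  refine sum_congr rfl fun i _ => ?_
  refine card_nbij' (fun j => (i, j)) Prod.snd ?_ ?_ ?_ ?_
  · intro j hj
    simpa [mem_outNbrs] using hj
  · rintro ⟨a, b⟩ hab
    simp only [coe_filter, Set.mem_ofPred_eq] at hab
    obtain ⟨h, rfl⟩ := hab
    simpa [mem_outNbrs] using h
  · intro j _
    rfl
  · rintro ⟨a, b⟩ hab
    simp only [coe_filter, Set.mem_ofPred_eq] at hab
    obtain ⟨_, rfl⟩ := hab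
    rfl

lemma outNbrs_subset_iff {n : ℕ} {E F : Finset (Fin n × Fin n)} :
    (∀ i, outNbrs n E i ⊆ outNbrs n F i) ↔ E ⊆ F := by
  constructor
  · rintro h ⟨a, b⟩ hab
    exact mem_outNbrs.1 (h a (mem_outNbrs.2 hab))
  · intro h i j hj
    exact mem_outNbrs.2 (h (mem_outNbrs.1 hj))

lemma outNbrs_allDirEdges (n : ℕ) (i : Fin n) : outNbrs n (allDirEdges n) i = univ.erase i := by
  ext j
  simp [mem_outNbrs, allDirEdges, eq_comm]

lemma outNbrs_subset_erase {n : ℕ} {E : Finset (Fin n × Fin n)} (hE : E ⊆ allDirEdges n)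
    (i : Fin n) : outNbrs n E i ⊆ univ.erase i := by
  rw [← outNbrs_allDirEdges]
  exact outNbrs_subset_iff.2 hE i

lemma dProb_eq_prod {n : ℕ} (p : ℝ) {E : Finset (Fin n × Fin n)} (hE : E ⊆ allDirEdges n) :
    dProb n p E = ∏ i : Fin n, (p ^ (outNbrs n E i).card *
      (1 - p) ^ ((univ.erase i).card - (outNbrs n E i).card)) := by
  rw [prod_mul_distrib, prod_pow_eq_pow_sum, prod_pow_eq_pow_sum, sum_card_outNbrs,
    sum_tsub_distrib _ fun i _ => card_le_card (outNbrs_subset_erase hE i), sum_card_outNbrs]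
  simp_rw [← outNbrs_allDirEdges]
  rw [sum_card_outNbrs, dProb]

/-- The out-neighbourhoods of distinct nodes are independent. -/
lemma dExp_prod_outNbrs (n : ℕ) (p : ℝ) (g : Fin n → Finset (Fin n) → ℝ) :
    dExp n p (fun E => ∏ i, g i (outNbrs n E i)) =
      ∏ i : Fin n, ∑ S ∈ (univ.erase i).powerset,
        p ^ S.card * (1 - p) ^ ((univ.erase i).card - S.card) * g i S := by
  rw [prod_univ_sum, dExp]
  refine sum_nbij' (fun E i => outNbrs n E i)
    (fun F => univ.filter fun e : Fin n × Fin n => e.2 ∈ F e.1) ?_ ?_ ?_ ?_ ?_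
  · intro E hE
    rw [mem_powerset] at hE
    simp only [Fintype.mem_piFinset, mem_powerset]
    exact outNbrs_subset_erase hE
  · intro F hF
    simp only [Fintype.mem_piFinset, mem_powerset] at hF
    rw [mem_powerset]
    rintro ⟨a, b⟩ hab
    have hb : b ∈ F a := by simpa using hab
    have := hF a hb
    simpa [allDirEdges, eq_comm] using this
  · intro E _
    ext ⟨a, b⟩
    simp [mem_outNbrs]
  · intro F _
    funext i
    ext j
    simp [mem_outNbrs]
  · intro E hE
    rw [mem_powerset] at hE
    rw [dProb_eq_prod p hE, ← prod_mul_distrib]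

lemma dExp_congr {n : ℕ} {p : ℝ} {X Y : Finset (Fin n × Fin n) → ℝ}
    (h : ∀ E ⊆ allDirEdges n, X E = Y E) : dExp n p X = dExp n p Y :=
  sum_congr rfl fun E hE => by rw [h E (mem_powerset.1 hE)]

lemma dCondExp_eq_div (n : ℕ) (p : ℝ) (X : Finset (Fin n × Fin n) → ℝ)
    (A : Finset (Fin n × Fin n) → Prop) [DecidablePred A] :
    dCondExp n p X A =
      dExp n p (fun E => if A E then X E else 0) / dExp n p (fun E => if A E then 1 else 0) := by
  rw [dCondExp]
  congr!

lemma finvD_eq {n : ℕ} {E : Finset (Fin n × Fin n)} (hE : E ⊆ allDirEdges n) (i : Fin n) :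
    finvD n E i = 1 / ((outNbrs n E i).card : ℝ) := by
  have h : degPlus n E i = (outNbrs n E i).card := by
    rw [degPlus]
    congr 1
    ext j
    simp only [mem_filter, mem_univ, true_and, mem_outNbrs, and_iff_right_iff_imp]
    intro hj
    have := hE hj
    simpa [allDirEdges, eq_comm] using this
  rw [finvD, h]
  split_ifs with h0
  · simp [h0]
  · rfl

/-- The expectation of `∏ i, φ i (deg⁺ i)` over graphs containing the edge set `T`. -/
lemma dExp_prod_card_superset {n : ℕ} (p : ℝ) {T : Finset (Fin n × Fin n)}
    (hT : T ⊆ allDirEdges n) (φ : Fin n → ℕ → ℝ) :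
    dExp n p (fun E => if T ⊆ E then ∏ i, φ i (outNbrs n E i).card else 0) =
      p ^ T.card * ∏ i : Fin n, ∑ j ∈ range ((univ.erase i \ outNbrs n T i).card + 1),
        ((univ.erase i \ outNbrs n T i).card.choose j : ℝ) *
          (p ^ j * (1 - p) ^ ((univ.erase i \ outNbrs n T i).card - j)) *
          φ i (j + (outNbrs n T i).card) := by
  have h := dExp_prod_outNbrs n p fun i S => if outNbrs n T i ⊆ S then φ i S.card else 0
  simp only [Fintype.prod_ite_zero, outNbrs_subset_iff] at h
  rw [h, ← sum_card_outNbrs, ← prod_pow_eq_pow_sum, ← prod_mul_distrib]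
  exact prod_congr rfl fun i _ => sum_powerset_superset (outNbrs_subset_erase hT i) p (φ i)

/-- **Lemma (upper bound along a directed trail).**
Let `G ∼ D(n,p)`, `k < n`, and let `c = c₁⋯c_{k+1}` be a trail of size `k` with
no two equal consecutive nodes.  Writing the product of truncated inverse
out-degrees grouped by the distinct nodes among `c₁,…,c_k` — i.e.
`f_{i₁}^{m₁} ⋯ f_{i_s}^{m_s} = ∏_{r=1}^k f_{c_r}` — and letting `|c|` denote
the number of distinct directed edges among `(c₁,c₂),…,(c_k,c_{k+1})`, we have
`E(∏_{r=1}^k f_{c_r} | 1_c = 1) ≤ k^{k−|c|}/(p^k (n−k)^k)`. -/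
theorem condExp_directed_trail_upper_bound
    (n k : ℕ) (hkn : k < n) (p : ℝ) (hp : p ∈ Set.Ioo (0 : ℝ) 1)
    (c : Fin (k + 1) → Fin n)
    (hcons : ∀ r : Fin k, c r.castSucc ≠ c r.succ) :
    dCondExp n p (fun E => ∏ r : Fin k, finvD n E (c r.castSucc))
        (fun E => ∀ r : Fin k, (c r.castSucc, c r.succ) ∈ E) ≤
      (k : ℝ) ^ (k - (Finset.univ.image fun r : Fin k => (c r.castSucc, c r.succ)).card) /
        (p ^ k * ((n : ℝ) - k) ^ k) := by
  obtain ⟨hp0, hp1⟩ := hp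
  set T := Finset.univ.image fun r : Fin k => (c r.castSucc, c r.succ) with hTdef
  set m : Fin n → ℕ := fun i => (Finset.univ.filter fun r : Fin k => c r.castSucc = i).card
    with hm
  have hT : T ⊆ allDirEdges n := by
    intro e he
    obtain ⟨r, -, rfl⟩ := mem_image.1 he
    simpa [allDirEdges] using hcons r
  have hmem : ∀ E : Finset (Fin n × Fin n),
      (∀ r : Fin k, (c r.castSucc, c r.succ) ∈ E) ↔ T ⊆ E := fun E => by
    simp [hTdef, image_subset_iff]
  have hmsum : ∑ i, m i = k := by
    have := card_eq_sum_card_fiberwise (s := (univ : Finset (Fin k)))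
      (f := fun r => c r.castSucc) (t := univ) (fun _ _ => by simp)
    simpa using this.symm
  have hmk : ∀ i, m i ≤ k := fun i =>
    (single_le_sum (fun _ _ => Nat.zero_le _) (mem_univ i)).trans hmsum.le
  have hbm : ∀ i, (outNbrs n T i).card ≤ m i := by
    intro i
    refine (card_le_card (t := (univ.filter fun r : Fin k => c r.castSucc = i).image
      fun r => c r.succ) fun j hj => ?_).trans card_image_le
    obtain ⟨r, -, hr⟩ := mem_image.1 (mem_outNbrs.1 hj)
    rw [Prod.mk.injEq] at hr
    exact mem_image.2 ⟨r, by simp [hr.1], hr.2⟩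
  have hb0 : ∀ i, (outNbrs n T i).card = 0 → m i = 0 := by
    intro i hi
    rw [card_eq_zero] at hi
    rw [hm, card_eq_zero, filter_eq_empty_iff]
    rintro r - rfl
    have : c r.succ ∈ outNbrs n T (c r.castSucc) :=
      mem_outNbrs.2 (mem_image_of_mem _ (mem_univ r))
    simp [hi] at this
  have hnum : dExp n p (fun E => if ∀ r : Fin k, (c r.castSucc, c r.succ) ∈ E then
      ∏ r : Fin k, finvD n E (c r.castSucc) else 0) =
      dExp n p (fun E => if T ⊆ E then
        ∏ i, (fun d : ℕ => (1 / (d : ℝ)) ^ m i) (outNbrs n E i).card else 0) := by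
    refine dExp_congr fun E hE => ?_
    simp only [hmem]
    congr 1
    rw [← prod_fiberwise univ (fun r : Fin k => c r.castSucc)]
    refine prod_congr rfl fun i _ => ?_
    rw [prod_congr rfl (g := fun _ => 1 / ((outNbrs n E i).card : ℝ)), prod_const]
    intro r hr
    rw [(mem_filter.1 hr).2, finvD_eq hE]
  have hden : dExp n p (fun E => if ∀ r : Fin k, (c r.castSucc, c r.succ) ∈ E then 1 else 0) =
      p ^ T.card := by
    have h := dExp_prod_card_superset p hT (fun _ _ => 1)
    simp only [prod_const_one, mul_one] at h
    simp only [hmem]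
    rw [h, prod_eq_one, mul_one]
    intro i _
    have hbin := add_pow p (1 - p) (univ.erase i \ outNbrs n T i).card
    rw [add_sub_cancel, one_pow] at hbin
    exact (sum_congr rfl fun j _ => by ring).trans hbin.symm
  have hq : 0 ≤ 1 - p := by linarith
  have hD0 : (0 : ℝ) < (n : ℝ) - k := sub_pos.2 (by exact_mod_cast hkn)
  rw [dCondExp_eq_div, hnum, hden, dExp_prod_card_superset p hT fun i (d : ℕ) => (1 / (d : ℝ)) ^ m i,
    mul_div_cancel_left₀ _ (pow_pos hp0 _).ne']
  calc _ ≤ ∏ i : Fin n, (k : ℝ) ^ (m i - (outNbrs n T i).card) /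
        (p ^ m i * ((n : ℝ) - k) ^ m i) := by
        refine prod_le_prod (fun i _ => sum_nonneg fun j _ => by positivity) fun i _ => ?_
        refine sum_binomial_inv_pow_le hp0 hp1 (hb0 i) (hbm i) (hmk i) hD0 fun hmi => ?_
        have hcard := card_sdiff_add_card_eq_card (outNbrs_subset_erase hT i)
        rw [card_erase_of_mem (mem_univ i), card_univ, Fintype.card_fin] at hcard
        have h1 := (hbm i).trans (hmk i)
        rw [sub_le_iff_le_add]
        exact_mod_cast (by omega :
          n ≤ (univ.erase i \ outNbrs n T i).card + 1 + k)
    _ = _ := by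
        rw [prod_div_distrib, prod_mul_distrib, prod_pow_eq_pow_sum, prod_pow_eq_pow_sum,
          prod_pow_eq_pow_sum, sum_tsub_distrib _ fun i _ => hbm i, hmsum, sum_card_outNbrs]
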